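/- Let K and L be geometric simplicial complexes in ℝ^N with |K| ⊆ |L|. Then there exist r ∈ ℕ, an r-fold derived subdivision β^r L of L, and a subdivision K' of K such that K' is a subcomplex of β^r L. -/

import Mathlib

open Set
open scoped Classical

variable {E : Type*} [NormedAddCommGroup E] [NormedSpace ℝ E]

/-- `K'` is a subdivision of `K`: same support, and every simplex of `K'` is contained in
some simplex of `K`. -/
def IsSubdivision (K' K : Geometry.SimplicialComplex ℝ E) : Prop :=
  K'.space = K.space ∧
    ∀ s ∈ K'.faces, ∃ t ∈ K.faces, convexHull ℝ (s : Set E) ⊆ convexHull ℝ (t : Set E)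

/-- `K'` is a derived subdivision of `K`: for each simplex `A` of `K` an interior point `b A`
(in the relative interior of its convex hull; for a vertex this forces `b {x} = x`) is chosen,
and the simplices of `K'` are exactly the convex hulls of the sets `{b A₀, …, b Aₖ}` for chains
`A₀ ⊊ ⋯ ⊊ Aₖ` of simplices of `K`. -/
def IsDerivedSubdivision (K' K : Geometry.SimplicialComplex ℝ E) : Prop :=
  ∃ b : Finset E → E,
    (∀ s ∈ K.faces, b s ∈ intrinsicInterior ℝ (convexHull ℝ (s : Set E))) ∧
    K'.faces = {S | ∃ T : Finset (Finset E), ↑T ⊆ K.faces ∧ T.Nonempty ∧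
      (∀ A ∈ T, ∀ B ∈ T, A ⊆ B ∨ B ⊆ A) ∧ S = T.image b}

/-- `K'` is an `s`-fold iterated derived subdivision of `K`. -/
def IsIterDerived : ℕ → Geometry.SimplicialComplex ℝ E → Geometry.SimplicialComplex ℝ E → Prop
  | 0, K', K => K' = K
  | (s + 1), K', K => ∃ K'', IsIterDerived s K'' K ∧ IsDerivedSubdivision K' K''

/-- The geometric bistellar move `κ(A,B)` on an `n`-dimensional complex: `A` is a simplex of `K`,
`B` is a simplex not in `K` with `dim A + dim B = n` (i.e. `card A + card B = n + 2`), the link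
of `A` in `K` is the boundary complex of `B`, and `K'` is obtained from `K` by replacing
`A ⋆ ∂B` (the simplices containing `A`) with `∂A ⋆ B`; the result is again a geometric
simplicial complex with the same support. -/
def BistellarMove (n : ℕ) (K K' : Geometry.SimplicialComplex ℝ E) : Prop :=
  ∃ A B : Finset E, A ∈ K.faces ∧ B ∉ K.faces ∧ B.Nonempty ∧
    A.card + B.card = n + 2 ∧
    {C : Finset E | C.Nonempty ∧ Disjoint A C ∧ A ∪ C ∈ K.faces} =
      {C : Finset E | C.Nonempty ∧ C ⊂ B} ∧
    K'.faces = (K.faces \ {s | A ⊆ s}) ∪ {s | ∃ A' : Finset E, A' ⊂ A ∧ s = A' ∪ B} ∧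
    K'.space = K.space

/-- `h` is a regular function for the triangulation `K` of a flat `d`-dimensional polyhedron:
it is affine on each simplex of `K` and strictly convex across each codimension-one simplex,
i.e. for `x`, `y` in distinct `d`-simplices sharing a common `(d-1)`-face, the open segment
from `(x, h x)` to `(y, h y)` lies strictly above the graph of `h`. -/
def IsRegularFunction (d : ℕ) (K : Geometry.SimplicialComplex ℝ E) (h : E → ℝ) : Prop :=
  (∀ s ∈ K.faces, ∃ g : E →ᵃ[ℝ] ℝ, ∀ x ∈ convexHull ℝ (s : Set E), h x = g x) ∧
  (∀ σ ∈ K.faces, ∀ σ' ∈ K.faces, σ ≠ σ' → σ.card = d + 1 → σ'.card = d + 1 →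
    (σ ∩ σ').card = d →
    ∀ x ∈ convexHull ℝ (σ : Set E), ∀ y ∈ convexHull ℝ (σ' : Set E),
      ∀ t : ℝ, t ∈ Set.Ioo (0 : ℝ) 1 → (1 - t) • x + t • y ∈ K.space →
        h ((1 - t) • x + t • y) < (1 - t) * h x + t * h y)

/-- `K` is a regular triangulation (of a flat `d`-dimensional polyhedron). -/
def IsRegularTriangulation (d : ℕ) (K : Geometry.SimplicialComplex ℝ E) : Prop :=
  ∃ h : E → ℝ, IsRegularFunction d K h

/-- `P` is strictly star-convex: there is an interior point `x` such that for every `y ∈ P`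
the open segment from `x` to `y` lies in the interior of `P`. -/
def StrictlyStarConvex (P : Set E) : Prop :=
  ∃ x ∈ interior P, ∀ y ∈ P, ∀ t ∈ Set.Ioo (0 : ℝ) 1, (1 - t) • x + t • y ∈ interior P



/-- The linear map sending finitely supported weights on `ι` to the pair of the weighted sum of
the points `p i` and the total weight. -/
noncomputable def weightedSum {ι : Type*} (p : ι → E) : (ι →₀ ℝ) →ₗ[ℝ] E × ℝ :=
  Finsupp.linearCombination ℝ fun i => (p i, (1 : ℝ))

lemma weightedSum_single {ι : Type*} (p : ι → E) (i : ι) :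
    weightedSum p (Finsupp.single i 1) = (p i, 1) := by
  simp [weightedSum]

lemma weightedSum_apply_of_support_subset {ι : Type*} (p : ι → E) {T : Finset ι} {c : ι →₀ ℝ}
    (hc : c.support ⊆ T) : weightedSum p c = (∑ i ∈ T, c i • p i, ∑ i ∈ T, c i) := by
  rw [weightedSum, Finsupp.linearCombination_apply,
    Finsupp.sum_of_support_subset c hc _ (by simp)]
  simp [Prod.ext_iff, Prod.fst_sum, Prod.snd_sum]

lemma mem_convexHull_image_iff {ι : Type*} (p : ι → E) (T : Finset ι) (x : E) :
    x ∈ convexHull ℝ (p '' (T : Set ι)) ↔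
      ∃ c : ι →₀ ℝ, 0 ≤ c ∧ c.support ⊆ T ∧ weightedSum p c = (x, 1) := by
  constructor
  · intro hx
    refine convexHull_min (t := {x | ∃ c : ι →₀ ℝ, 0 ≤ c ∧ c.support ⊆ T ∧
      weightedSum p c = (x, 1)}) ?_ ?_ hx
    · rintro _ ⟨i, hi, rfl⟩
      refine ⟨Finsupp.single i 1, by simp, ?_, weightedSum_single p i⟩
      exact Finsupp.support_single_subset.trans (by simpa using hi)
    · rintro x ⟨c, hc0, hcT, hc⟩ y ⟨d, hd0, hdT, hd⟩ a b ha hb hab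
      refine ⟨a • c + b • d, add_nonneg (smul_nonneg ha hc0) (smul_nonneg hb hd0), ?_, ?_⟩
      · exact Finsupp.support_add.trans (Finset.union_subset
          (Finsupp.support_smul.trans hcT) (Finsupp.support_smul.trans hdT))
      · simp [hc, hd, hab]
  · rintro ⟨c, hc0, hcT, hc⟩
    rw [weightedSum_apply_of_support_subset p hcT, Prod.mk.injEq] at hc
    rw [← hc.1]
    exact (convex_convexHull ℝ _).sum_mem (fun i _ => hc0 i) hc.2
      fun i hi => subset_convexHull ℝ _ ⟨i, hi, rfl⟩

lemma mem_convexHull_finset_iff (s : Finset E) (x : E) :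
    x ∈ convexHull ℝ (s : Set E) ↔
      ∃ c : E →₀ ℝ, 0 ≤ c ∧ c.support ⊆ s ∧ weightedSum id c = (x, 1) := by
  simpa using mem_convexHull_image_iff (id : E → E) s x

lemma AffineIndependent.eq_zero_of_weightedSum_eq_zero {s : Finset E}
    (hs : AffineIndependent ℝ ((↑) : s → E)) {c : E →₀ ℝ} (hc : c.support ⊆ s)
    (h : weightedSum id c = 0) : c = 0 := by
  rw [weightedSum_apply_of_support_subset id hc, Prod.mk_eq_zero] at h
  have key := affineIndependent_iff.1 hs Finset.univ (fun v => c v)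
    ((Finset.sum_coe_sort s fun v => c v).trans h.2)
    ((Finset.sum_coe_sort s fun v => c v • v).trans h.1)
  ext v
  by_cases hv : v ∈ s
  · exact key ⟨v, hv⟩ (Finset.mem_univ _)
  · exact Finsupp.notMem_support_iff.1 fun h' => hv (hc h')

lemma AffineIndependent.eq_of_weightedSum_eq {s : Finset E}
    (hs : AffineIndependent ℝ ((↑) : s → E)) {c d : E →₀ ℝ} (hc : c.support ⊆ s)
    (hd : d.support ⊆ s) (h : weightedSum id c = weightedSum id d) : c = d :=
  sub_eq_zero.1 <| hs.eq_zero_of_weightedSum_eq_zero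
    (Finsupp.support_sub.trans (Finset.union_subset hc hd)) (by rw [map_sub, h, sub_self])

/-- Nonnegative weights supported on faces of a simplicial complex are determined by their
weighted sum and their total weight. -/
lemma Geometry.SimplicialComplex.eq_of_weightedSum_eq (K : Geometry.SimplicialComplex ℝ E)
    {s t : Finset E} (hs : s ∈ K.faces) (ht : t ∈ K.faces) {c d : E →₀ ℝ}
    (hc0 : 0 ≤ c) (hd0 : 0 ≤ d) (hc : c.support ⊆ s) (hd : d.support ⊆ t)
    (h : weightedSum id c = weightedSum id d) : c = d := by
  obtain ⟨a, hca⟩ : ∃ a, (weightedSum id c).2 = a := ⟨_, rfl⟩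
  have hda : (weightedSum id d).2 = a := by rw [← h, hca]
  have eq_zero : ∀ {c : E →₀ ℝ} {s : Finset E}, 0 ≤ c → c.support ⊆ s →
      (weightedSum id c).2 = 0 → c = 0 := by
    intro c s hc0 hc h
    rw [weightedSum_apply_of_support_subset id hc,
      Finset.sum_eq_zero_iff_of_nonneg fun i _ => hc0 i] at h
    ext v
    by_cases hv : v ∈ s
    · exact h v hv
    · exact Finsupp.notMem_support_iff.1 fun h' => hv (hc h')
  have ha : 0 ≤ a := by
    rw [← hca, weightedSum_apply_of_support_subset id hc]
    exact Finset.sum_nonneg fun i _ => hc0 i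
  rcases ha.eq_or_lt with rfl | ha
  · rw [eq_zero hc0 hc hca, eq_zero hd0 hd hda]
  have hne : a ≠ 0 := ha.ne'
  have hsmul : ∀ {c : E →₀ ℝ}, (weightedSum id c).2 = a →
      weightedSum id (a⁻¹ • c) = (a⁻¹ • (weightedSum id c).1, 1) := by
    intro c h
    rw [map_smul, Prod.ext_iff]
    simp [h, hne]
  have hxs : a⁻¹ • (weightedSum id c).1 ∈ convexHull ℝ (s : Set E) :=
    (mem_convexHull_finset_iff _ _).2 ⟨a⁻¹ • c, smul_nonneg (inv_nonneg.2 ha.le) hc0,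
      Finsupp.support_smul.trans hc, hsmul hca⟩
  have hxt : a⁻¹ • (weightedSum id c).1 ∈ convexHull ℝ (t : Set E) :=
    (mem_convexHull_finset_iff _ _).2 ⟨a⁻¹ • d, smul_nonneg (inv_nonneg.2 ha.le) hd0,
      Finsupp.support_smul.trans hd, by rw [hsmul hda, h]⟩
  have hx := K.inter_subset_convexHull hs ht ⟨hxs, hxt⟩
  rw [← Finset.coe_inter, mem_convexHull_finset_iff] at hx
  obtain ⟨e, -, he, hex⟩ := hx
  have h1 : a⁻¹ • c = e := (K.indep hs).eq_of_weightedSum_eq (Finsupp.support_smul.trans hc)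
    (he.trans Finset.inter_subset_left) (by rw [hex, hsmul hca])
  have h2 : a⁻¹ • d = e := (K.indep ht).eq_of_weightedSum_eq (Finsupp.support_smul.trans hd)
    (he.trans Finset.inter_subset_right) (by rw [hex, hsmul hda, h])
  exact smul_right_injective _ (inv_ne_zero hne) (h1.trans h2.symm)

/-- A family of finite sets of labelled points, closed under nonempty subsets, spans a simplicial
complex as soon as nonnegative weights supported on members of the family are determined by their
weighted sum and their total weight. -/
lemma exists_simplicialComplex_of_weightedSum {ι : Type*} (p : ι → E) (F : Set (Finset ι))
    (hF : ∀ T ∈ F, T.Nonempty) (hsub : ∀ T ∈ F, ∀ T' ⊆ T, T'.Nonempty → T' ∈ F)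
    (hinj : ∀ T ∈ F, ∀ T' ∈ F, ∀ c d : ι →₀ ℝ, 0 ≤ c → 0 ≤ d → c.support ⊆ T →
      d.support ⊆ T' → weightedSum p c = weightedSum p d → c = d) :
    ∃ K : Geometry.SimplicialComplex ℝ E, K.faces = {S | ∃ T ∈ F, S = T.image p} := by
  have hindep : ∀ T ∈ F, AffineIndependent ℝ (fun i : T => p i) := by
    intro T hT
    rw [affineIndependent_iff]
    intro S w hw hwp
    obtain ⟨g, hg⟩ : ∃ g : ι →₀ ℝ, g = ∑ i ∈ S, Finsupp.single (i : ι) (w i) := ⟨_, rfl⟩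
    have hg0 : weightedSum p g = 0 := by
      rw [hg, map_sum]
      simp only [weightedSum, Finsupp.linearCombination_single]
      simp only [Prod.smul_mk, smul_eq_mul, mul_one]
      rw [Prod.ext_iff, Prod.fst_sum, Prod.snd_sum]
      exact ⟨hwp, hw⟩
    have hgT : g.support ⊆ T := by
      rw [hg]
      refine Finsupp.support_finsetSum.trans (Finset.biUnion_subset.2 fun i _ => ?_)
      exact Finsupp.support_single_subset.trans (by simp)
    have hmap : ∀ f : ℝ → ℝ, ∀ hf : f 0 = 0, (g.mapRange f hf).support ⊆ T := fun f hf =>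
      Finsupp.support_mapRange.trans hgT
    have heq := hinj T hT T hT (g.mapRange (fun x => max x 0) (by simp))
      (g.mapRange (fun x => max (-x) 0) (by simp)) (fun i => by simp) (fun i => by simp)
      (hmap _ _) (hmap _ _) (by
        rw [← sub_eq_zero, ← map_sub, ← hg0]
        congr 1
        ext i
        simp only [Finsupp.sub_apply, Finsupp.mapRange_apply]
        rcases le_total 0 (g i) with h | h
        · rw [max_eq_left h, max_eq_right (by linarith)]; ring
        · rw [max_eq_right h, max_eq_left (by linarith)]; ring)
    intro i hi
    have hi' : g i = 0 := by
      have := DFunLike.congr_fun heq (i : ι)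
      simp only [Finsupp.mapRange_apply] at this
      rcases le_total 0 (g i) with h | h
      · rwa [max_eq_left h, max_eq_right (by linarith)] at this
      · rw [max_eq_right h, max_eq_left (by linarith)] at this; linarith
    rw [hg, Finsupp.finsetSum_apply, Finset.sum_eq_single_of_mem i hi] at hi'
    · simpa using hi'
    · intro j _ hji
      exact Finsupp.single_eq_of_ne fun h => hji (Subtype.ext h.symm)
  refine ⟨{ faces := {S | ∃ T ∈ F, S = T.image p}
            isRelLowerSet_faces := ?_
            indep := ?_
            inter_subset_convexHull := ?_ }, rfl⟩
  · rintro _ ⟨T, hT, rfl⟩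
    refine ⟨(hF T hT).image p, fun S hS hne => ?_⟩
    obtain ⟨T', hT', rfl⟩ := Finset.subset_image_iff.1 hS
    exact ⟨T', hsub T hT T' hT' (Finset.image_nonempty.1 hne), rfl⟩
  · rintro _ ⟨T, hT, rfl⟩
    have h := (hindep T hT).range
    have hr : Set.range (fun i : T => p i) = ((T.image p : Finset E) : Set E) := by
      ext x; simp
    rw [hr] at h
    exact h
  · rintro _ _ ⟨T, hT, rfl⟩ ⟨T', hT', rfl⟩ x ⟨hx, hx'⟩
    rw [Finset.coe_image, mem_convexHull_image_iff] at hx hx'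
    obtain ⟨c, hc0, hcT, hc⟩ := hx
    obtain ⟨d, hd0, hdT, hd⟩ := hx'
    obtain rfl := hinj T hT T' hT' c d hc0 hd0 hcT hdT (hc.trans hd.symm)
    have hx : x ∈ convexHull ℝ (p '' ((T ∩ T' : Finset ι) : Set ι)) :=
      (mem_convexHull_image_iff _ _ _).2 ⟨c, hc0, Finset.subset_inter hcT hdT, hc⟩
    refine convexHull_mono ?_ hx
    rw [Finset.coe_inter, Finset.coe_image, Finset.coe_image]
    exact Set.image_inter_subset p _ _

/-- If `β A` is a nonnegative weight with support exactly `A`, then the support of a nonnegative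
combination of the `β A` over a nonempty chain is the largest element of the chain. -/
lemma exists_mem_support_eq_support_linearCombination {α : Type*} {β : Finset α → α →₀ ℝ}
    {c : Finset α →₀ ℝ} (hβ : ∀ A ∈ c.support, 0 ≤ β A ∧ (β A).support = A) (hc0 : 0 ≤ c)
    (hchain : ∀ A ∈ c.support, ∀ B ∈ c.support, A ⊆ B ∨ B ⊆ A) (hc : c ≠ 0) :
    ∃ A ∈ c.support, (Finsupp.linearCombination ℝ β c).support = A := by
  obtain ⟨A, hA⟩ := c.support.exists_maximal (Finsupp.support_nonempty_iff.2 hc)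
  have hmax : ∀ B ∈ c.support, B ⊆ A := fun B hB =>
    (hchain A hA.prop B hB).elim (fun h => hA.le_of_ge hB h) id
  refine ⟨A, hA.prop, ?_⟩
  have happ : ∀ v, Finsupp.linearCombination ℝ β c v = ∑ B ∈ c.support, c B * β B v := by
    intro v
    rw [Finsupp.linearCombination_apply, Finsupp.sum, Finsupp.finsetSum_apply]
    rfl
  ext v
  rw [Finsupp.mem_support_iff, happ]
  constructor
  · intro h
    obtain ⟨B, hB, hne⟩ := Finset.exists_ne_zero_of_sum_ne_zero h
    refine hmax B hB ?_
    rw [← (hβ B hB).2, Finsupp.mem_support_iff]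
    exact right_ne_zero_of_mul hne
  · intro hv h
    rw [Finset.sum_eq_zero_iff_of_nonneg fun B hB => mul_nonneg (hc0 B) ((hβ B hB).1 v)] at h
    rcases mul_eq_zero.1 (h A hA.prop) with h | h
    · exact Finsupp.mem_support_iff.1 hA.prop h
    · rw [← (hβ A hA.prop).2, Finsupp.mem_support_iff] at hv
      exact hv h

/-- If `β A` is a nonnegative weight with support exactly `A`, then a nonnegative combination of
the `β A` over a chain of nonempty sets determines its coefficients. -/
lemma eq_of_linearCombination_eq_of_chain {α : Type*} {β : Finset α → α →₀ ℝ}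
    {F : Set (Finset α)} (hF : ∀ A ∈ F, A.Nonempty)
    (hβ : ∀ A ∈ F, 0 ≤ β A ∧ (β A).support = A) {c d : Finset α →₀ ℝ} (hc0 : 0 ≤ c) (hd0 : 0 ≤ d)
    (hcF : ∀ A ∈ c.support, A ∈ F) (hdF : ∀ A ∈ d.support, A ∈ F)
    (hc : ∀ A ∈ c.support, ∀ B ∈ c.support, A ⊆ B ∨ B ⊆ A)
    (hd : ∀ A ∈ d.support, ∀ B ∈ d.support, A ⊆ B ∨ B ⊆ A)
    (h : Finsupp.linearCombination ℝ β c = Finsupp.linearCombination ℝ β d) : c = d := by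
  have disj : ∀ {c d : Finset α →₀ ℝ}, 0 ≤ c → 0 ≤ d → (∀ A ∈ c.support, A ∈ F) →
      (∀ A ∈ d.support, A ∈ F) → (∀ A ∈ c.support, ∀ B ∈ c.support, A ⊆ B ∨ B ⊆ A) →
      (∀ A ∈ d.support, ∀ B ∈ d.support, A ⊆ B ∨ B ⊆ A) →
      Finsupp.linearCombination ℝ β c = Finsupp.linearCombination ℝ β d →
      (∀ A ∈ c.support, A ∉ d.support) → c = 0 := by
    intro c d hc0 hd0 hcF hdF hc hd h hcd
    by_contra hne
    obtain ⟨A, hA, hAs⟩ := exists_mem_support_eq_support_linearCombination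
      (fun A hA => hβ A (hcF A hA)) hc0 hc hne
    have hne' : d ≠ 0 := by
      rintro rfl
      rw [h, map_zero, Finsupp.support_zero] at hAs
      exact (hF A (hcF A hA)).ne_empty hAs.symm
    obtain ⟨B, hB, hBs⟩ := exists_mem_support_eq_support_linearCombination
      (fun A hA => hβ A (hdF A hA)) hd0 hd hne'
    rw [h, hBs] at hAs
    exact hcd A hA (hAs ▸ hB)
  have hsub : ∀ {c d : Finset α →₀ ℝ}, 0 ≤ c → 0 ≤ d → (c - c ⊓ d).support ⊆ c.support := by
    intro c d hc0 hd0 A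
    simp only [Finsupp.mem_support_iff, Finsupp.sub_apply, Finsupp.inf_apply]
    intro h h0
    have hdA : 0 ≤ d A := hd0 A
    rw [h0, min_eq_left hdA] at h
    exact h (sub_zero _)
  have hsub' : (d - c ⊓ d).support ⊆ d.support := by
    rw [inf_comm]; exact hsub hd0 hc0
  have hdisj : ∀ A ∈ (c - c ⊓ d).support, A ∉ (d - c ⊓ d).support := by
    intro A
    simp only [Finsupp.mem_support_iff, Finsupp.sub_apply, Finsupp.inf_apply, not_not]
    intro h
    rcases le_total (c A) (d A) with h' | h'
    · rw [min_eq_left h', sub_self] at h; exact absurd rfl h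
    · rw [min_eq_right h', sub_self]
  have h0c : 0 ≤ c - c ⊓ d := sub_nonneg.2 inf_le_left
  have h0d : 0 ≤ d - c ⊓ d := sub_nonneg.2 inf_le_right
  have heq : Finsupp.linearCombination ℝ β (c - c ⊓ d) =
      Finsupp.linearCombination ℝ β (d - c ⊓ d) := by rw [map_sub, map_sub, h]
  have h1 := disj h0c h0d (fun A hA => hcF A (hsub hc0 hd0 hA)) (fun A hA => hdF A (hsub' hA))
    (fun A hA B hB => hc A (hsub hc0 hd0 hA) B (hsub hc0 hd0 hB))
    (fun A hA B hB => hd A (hsub' hA) B (hsub' hB)) heq hdisj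
  have h2 := disj h0d h0c (fun A hA => hdF A (hsub' hA)) (fun A hA => hcF A (hsub hc0 hd0 hA))
    (fun A hA B hB => hd A (hsub' hA) B (hsub' hB))
    (fun A hA B hB => hc A (hsub hc0 hd0 hA) B (hsub hc0 hd0 hB)) heq.symm
    (fun A hA hA' => hdisj A hA' hA)
  rw [sub_eq_zero.1 h1, ← sub_eq_zero.1 h2]

/-- Every nonnegative weight supported on a member `s` of a family closed under nonempty subsets is
a nonnegative combination of the weights `β A` over a chain of members contained in `s`. -/
lemma exists_linearCombination_eq_of_support_subset {α : Type*} {β : Finset α → α →₀ ℝ}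
    {F : Set (Finset α)} (hsub : ∀ A ∈ F, ∀ B ⊆ A, B.Nonempty → B ∈ F)
    (hβ : ∀ A ∈ F, 0 ≤ β A ∧ (β A).support = A) (s : Finset α) (hs : s.Nonempty → s ∈ F)
    (w : α →₀ ℝ) (hw0 : 0 ≤ w) (hw : w.support ⊆ s) :
    ∃ c : Finset α →₀ ℝ, 0 ≤ c ∧ Finsupp.linearCombination ℝ β c = w ∧
      (∀ A ∈ c.support, A ∈ F ∧ A ⊆ s) ∧
      ∀ A ∈ c.support, ∀ B ∈ c.support, A ⊆ B ∨ B ⊆ A := by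
  induction s using Finset.strongInduction generalizing w with
  | H s ih =>
    rcases s.eq_empty_or_nonempty with rfl | hne
    · refine ⟨0, le_rfl, ?_, by simp, by simp⟩
      rw [map_zero, eq_comm, ← Finsupp.support_eq_empty]
      exact Finset.subset_empty.1 hw
    have hsF := hs hne
    have hpos : ∀ v ∈ s, 0 < β s v := fun v hv =>
      ((hβ s hsF).1 v).lt_of_ne' (Finsupp.mem_support_iff.1 (by rwa [(hβ s hsF).2]))
    have hzero : ∀ v ∉ s, β s v = 0 := fun v hv =>
      Finsupp.notMem_support_iff.1 (by rwa [(hβ s hsF).2])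
    obtain ⟨u, hu, hmin⟩ := s.exists_min_image (fun v => w v / β s v) hne
    have ht : 0 ≤ w u / β s u := div_nonneg (hw0 u) (hpos u hu).le
    have hle : 0 ≤ w - (w u / β s u) • β s := by
      intro v
      by_cases hv : v ∈ s
      · have := (le_div_iff₀ (hpos v hv)).1 (hmin v hv)
        simpa using this
      · simpa [hzero v hv] using hw0 v
    have hsupp : (w - (w u / β s u) • β s).support ⊆ s.erase u := by
      intro v hv
      rw [Finsupp.mem_support_iff, Finsupp.sub_apply, Finsupp.smul_apply, smul_eq_mul] at hv
      refine Finset.mem_erase.2 ⟨?_, ?_⟩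
      · rintro rfl
        exact hv (by rw [div_mul_cancel₀ _ (hpos v hu).ne', sub_self])
      · by_contra hvs
        rw [hzero v hvs, Finsupp.notMem_support_iff.1 fun h => hvs (hw h)] at hv
        simp at hv
    obtain ⟨c, hc0, hcw, hcF, hchain⟩ := ih (s.erase u) (Finset.erase_ssubset hu)
      (fun h => hsub s hsF _ (Finset.erase_subset _ _) h) _ hle hsupp
    have hmem : ∀ A ∈ (c + Finsupp.single s (w u / β s u)).support, A ∈ c.support ∨ A = s := by
      intro A hA
      rcases Finset.mem_union.1 (Finsupp.support_add hA) with h | h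
      · exact Or.inl h
      · exact Or.inr (Finset.mem_singleton.1 (Finsupp.support_single_subset h))
    have hcs : ∀ A ∈ c.support, A ⊆ s := fun A hA =>
      (hcF A hA).2.trans (Finset.erase_subset _ _)
    refine ⟨c + Finsupp.single s (w u / β s u),
      add_nonneg hc0 (Finsupp.single_nonneg.2 ht), ?_, ?_, ?_⟩
    · rw [map_add, hcw, Finsupp.linearCombination_single, sub_add_cancel]
    · intro A hA
      rcases hmem A hA with h | rfl
      · exact ⟨(hcF A h).1, hcs A h⟩
      · exact ⟨hsF, subset_rfl⟩
    · intro A hA B hB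
      rcases hmem A hA with h | rfl
      · rcases hmem B hB with h' | rfl
        · exact hchain A h B h'
        · exact Or.inl (hcs A h)
      · rcases hmem B hB with h' | rfl
        · exact Or.inr (hcs B h')
        · exact Or.inl subset_rfl

/-- The derived complex of `K` with derived points given by barycentric coordinates: `β s` is a
weight with support exactly `s`. -/
lemma exists_derived_of_weights (K : Geometry.SimplicialComplex ℝ E) (β : Finset E → E →₀ ℝ)
    (b : Finset E → E) (hβ : ∀ s ∈ K.faces, 0 ≤ β s ∧ (β s).support = s)
    (hb : ∀ s ∈ K.faces, weightedSum id (β s) = (b s, 1)) :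
    ∃ K' : Geometry.SimplicialComplex ℝ E, K.space ⊆ K'.space ∧
      K'.faces = {S | ∃ T : Finset (Finset E), ↑T ⊆ K.faces ∧ T.Nonempty ∧
        (∀ A ∈ T, ∀ B ∈ T, A ⊆ B ∨ B ⊆ A) ∧ S = T.image b} := by
  have hlin : ∀ c : Finset E →₀ ℝ, (∀ A ∈ c.support, A ∈ K.faces) →
      weightedSum id (Finsupp.linearCombination ℝ β c) = weightedSum b c := by
    intro c hc
    rw [weightedSum_apply_of_support_subset b subset_rfl, Finsupp.linearCombination_apply,
      Finsupp.sum, map_sum, Prod.ext_iff, Prod.fst_sum, Prod.snd_sum]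
    refine ⟨Finset.sum_congr rfl fun A hA => ?_, Finset.sum_congr rfl fun A hA => ?_⟩ <;>
      simp [hb A (hc A hA)]
  have hface : ∀ T : Finset (Finset E), ↑T ⊆ K.faces → T.Nonempty →
      (∀ A ∈ T, ∀ B ∈ T, A ⊆ B ∨ B ⊆ A) → ∀ c : Finset E →₀ ℝ, 0 ≤ c → c.support ⊆ T →
      0 ≤ Finsupp.linearCombination ℝ β c ∧
        ∃ s ∈ K.faces, (Finsupp.linearCombination ℝ β c).support ⊆ s := by
    intro T hT hne hchain c hc0 hcT
    constructor
    · rw [Finsupp.linearCombination_apply]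
      exact Finset.sum_nonneg fun A hA => smul_nonneg (hc0 A) (hβ A (hT (hcT hA))).1
    · by_cases hc : c = 0
      · obtain ⟨A, hA⟩ := hne
        exact ⟨A, hT hA, by simp [hc]⟩
      · obtain ⟨A, hA, h⟩ := exists_mem_support_eq_support_linearCombination
          (fun A hA => hβ A (hT (hcT hA))) hc0
          (fun A hA B hB => hchain A (hcT hA) B (hcT hB)) hc
        exact ⟨A, hT (hcT hA), h.subset⟩
  obtain ⟨K', hK'⟩ := exists_simplicialComplex_of_weightedSum b
    {T | ↑T ⊆ K.faces ∧ T.Nonempty ∧ ∀ A ∈ T, ∀ B ∈ T, A ⊆ B ∨ B ⊆ A} (fun T hT => hT.2.1)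
    (fun T hT T' hT' hne => ⟨(Finset.coe_subset.2 hT').trans hT.1, hne,
      fun A hA B hB => hT.2.2 A (hT' hA) B (hT' hB)⟩) (by
    rintro T ⟨hT, hTne, hTc⟩ T' ⟨hT', hTne', hTc'⟩ c d hc0 hd0 hcT hdT h
    refine eq_of_linearCombination_eq_of_chain
      (fun A hA => K.nonempty_of_mem_faces hA) hβ hc0 hd0
      (fun A hA => hT (hcT hA)) (fun A hA => hT' (hdT hA))
      (fun A hA B hB => hTc A (hcT hA) B (hcT hB))
      (fun A hA B hB => hTc' A (hdT hA) B (hdT hB)) ?_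
    obtain ⟨h0, s, hs, hss⟩ := hface T hT hTne hTc c hc0 hcT
    obtain ⟨h0', t, ht, htt⟩ := hface T' hT' hTne' hTc' d hd0 hdT
    refine K.eq_of_weightedSum_eq hs ht h0 h0' hss htt ?_
    rw [hlin c fun A hA => hT (hcT hA), hlin d fun A hA => hT' (hdT hA), h])
  refine ⟨K', ?_, ?_⟩
  · intro x hx
    obtain ⟨s, hs, hxs⟩ := Geometry.SimplicialComplex.mem_space_iff.1 hx
    obtain ⟨w, hw0, hws, hwx⟩ := (mem_convexHull_finset_iff _ _).1 hxs
    obtain ⟨c, hc0, hcw, hcF, hchain⟩ := exists_linearCombination_eq_of_support_subset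
      (fun A hA B hB hne => K.down_closed hA hB hne) hβ s (fun _ => hs) w hw0 hws
    have hcx : weightedSum b c = (x, 1) := by rw [← hlin c fun A hA => (hcF A hA).1, hcw, hwx]
    have hcne : c ≠ 0 := by
      rintro rfl
      simpa using congrArg Prod.snd hcx
    refine Geometry.SimplicialComplex.mem_space_iff.2 ⟨c.support.image b, ?_, ?_⟩
    · rw [hK']
      exact ⟨c.support, ⟨fun A hA => (hcF A hA).1, Finsupp.support_nonempty_iff.2 hcne, hchain⟩,
        rfl⟩
    · rw [Finset.coe_image, mem_convexHull_image_iff]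
      exact ⟨c, hc0, subset_rfl, hcx⟩
  · rw [hK']
    ext S
    simp only [Set.mem_ofPred_eq, and_assoc]

/-- Barycentric coordinates with respect to an affinely independent finite set extend to a linear
map on `E × ℝ`. -/
lemma AffineIndependent.exists_barycentric {s : Finset E}
    (hs : AffineIndependent ℝ ((↑) : s → E)) :
    ∃ g : E × ℝ →ₗ[ℝ] E →₀ ℝ, (∀ y, (g y).support ⊆ s) ∧
      ∀ c : E →₀ ℝ, c.support ⊆ s → g (weightedSum id c) = c := by
  have hker : LinearMap.ker ((weightedSum (id : E → E)).domRestrict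
      (Finsupp.supported ℝ ℝ (s : Set E))) = ⊥ := by
    rw [LinearMap.ker_eq_bot']
    rintro ⟨c, hc⟩ h
    exact Subtype.ext (hs.eq_zero_of_weightedSum_eq_zero
      (by simpa [Finsupp.mem_supported] using hc) h)
  obtain ⟨g, hg⟩ := LinearMap.exists_leftInverse_of_injective (K := ℝ)
    (V := Finsupp.supported ℝ ℝ (s : Set E)) (V' := E × ℝ) _ hker
  refine ⟨(Finsupp.supported ℝ ℝ (s : Set E)).subtype.comp g, fun y => ?_, fun c hc => ?_⟩
  · exact Finset.coe_subset.1 ((Finsupp.mem_supported ℝ _).1 (g y).2)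
  · have hc' : c ∈ Finsupp.supported ℝ ℝ (s : Set E) := by simpa [Finsupp.mem_supported] using hc
    exact congrArg Subtype.val (LinearMap.congr_fun hg ⟨c, hc'⟩)

/-- A simplex in a finite-dimensional space is a finite intersection of closed half-spaces. -/
lemma AffineIndependent.exists_finset_forall_nonneg_iff [FiniteDimensional ℝ E] {s : Finset E}
    (hs : AffineIndependent ℝ ((↑) : s → E)) :
    ∃ Φ : Finset (E × ℝ →ₗ[ℝ] ℝ), ∀ x, x ∈ convexHull ℝ (s : Set E) ↔ ∀ f ∈ Φ, 0 ≤ f (x, 1) := by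
  obtain ⟨g, hgs, hg⟩ := hs.exists_barycentric
  obtain ⟨δ, hδ⟩ : ∃ δ : E × ℝ →ₗ[ℝ] E × ℝ, δ = (weightedSum id).comp g - LinearMap.id := ⟨_, rfl⟩
  let B := Module.finBasis ℝ (E × ℝ)
  refine ⟨s.image (fun v => (Finsupp.lapply v).comp g) ∪
    (Finset.univ.image (fun j => (B.coord j).comp δ) ∪
      Finset.univ.image (fun j => -(B.coord j).comp δ)), fun x => ⟨fun hx => ?_, fun hx => ?_⟩⟩
  · obtain ⟨c, hc0, hcs, hcx⟩ := (mem_convexHull_finset_iff _ _).1 hx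
    have hgx : g (x, 1) = c := by rw [← hcx, hg c hcs]
    have hδx : δ (x, 1) = 0 := by simp [hδ, hgx, hcx]
    intro f hf
    simp only [Finset.mem_union, Finset.mem_image, Finset.mem_univ, true_and] at hf
    rcases hf with ⟨v, -, rfl⟩ | ⟨j, rfl⟩ | ⟨j, rfl⟩
    · simpa [hgx] using hc0 v
    · simp [hδx]
    · simp [hδx]
  · have hδx : δ (x, 1) = 0 := by
      refine B.ext_elem fun j => ?_
      have h1 := hx ((B.coord j).comp δ) (by simp)
      have h2 := hx (-(B.coord j).comp δ) (by simp)
      simp only [LinearMap.neg_apply, LinearMap.comp_apply, Module.Basis.coord_apply] at h1 h2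
      rw [map_zero, Finsupp.zero_apply]
      linarith
    refine (mem_convexHull_finset_iff _ _).2 ⟨g (x, 1), fun v => ?_, hgs _, ?_⟩
    · by_cases hv : v ∈ s
      · exact hx ((Finsupp.lapply v).comp g)
          (Finset.mem_union_left _ (Finset.mem_image_of_mem _ hv))
      · exact (Finsupp.notMem_support_iff.1 fun h => hv (hgs _ h)).ge
    · simpa [hδ, sub_eq_zero] using hδx

/-- A point of a simplex with positive barycentric coordinates lies in its relative interior. -/
lemma AffineIndependent.mem_intrinsicInterior_of_pos [FiniteDimensional ℝ E] {s : Finset E}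
    (hs : AffineIndependent ℝ ((↑) : s → E)) {w : E →₀ ℝ} {x : E} (hw : 0 ≤ w)
    (hws : w.support = s) (hx : weightedSum id w = (x, 1)) :
    x ∈ intrinsicInterior ℝ (convexHull ℝ (s : Set E)) := by
  obtain ⟨g, hgs, hg⟩ := hs.exists_barycentric
  have hspan : ∀ y ∈ affineSpan ℝ (convexHull ℝ (s : Set E)),
      weightedSum id (g (y, 1)) = (y, 1) := by
    intro y hy
    refine affineSpan_induction (p := fun y => weightedSum id (g (y, 1)) = (y, 1)) hy ?_ ?_
    · intro y hy
      obtain ⟨c, -, hcs, hcy⟩ := (mem_convexHull_finset_iff _ _).1 hy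
      rw [← hcy, hg c hcs]
    · intro c u v z hu hv hz
      have h : (c • (u -ᵥ v) +ᵥ z, (1 : ℝ)) = c • ((u, (1 : ℝ)) - (v, 1)) + (z, 1) := by
        simp
      rw [h]
      simp only [map_add, map_smul, map_sub, hu, hv, hz]
  have hxs : x ∈ convexHull ℝ (s : Set E) :=
    (mem_convexHull_finset_iff _ _).2 ⟨w, hw, hws.subset, hx⟩
  refine mem_intrinsicInterior.2 ⟨⟨x, subset_affineSpan ℝ _ hxs⟩, ?_, rfl⟩
  rw [mem_interior]
  refine ⟨⋂ v ∈ s, {y | 0 < g ((y : E), 1) v}, ?_, ?_, ?_⟩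
  · intro y hy
    simp only [Set.mem_iInter] at hy
    refine (mem_convexHull_finset_iff _ _).2 ⟨g ((y : E), 1), fun v => ?_, hgs _, hspan y y.2⟩
    by_cases hv : v ∈ s
    · exact (hy v hv).le
    · exact (Finsupp.notMem_support_iff.1 fun h => hv (hgs _ h)).ge
  · refine s.finite_toSet.isOpen_biInter fun v _ => ?_
    have hcont : Continuous ((Finsupp.lapply v : (E →₀ ℝ) →ₗ[ℝ] ℝ).comp g) :=
      LinearMap.continuous_of_finiteDimensional _
    exact isOpen_lt continuous_const (hcont.comp (continuous_subtype_val.prodMk continuous_const))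
  · refine Set.mem_iInter₂.2 fun v hv => ?_
    change 0 < g (x, 1) v
    rw [← hx, hg w hws.subset]
    exact (hw v).lt_of_ne' (Finsupp.mem_support_iff.1 (by rwa [hws]))

/-- The affine function `x ↦ f (x, 1)` does not take both signs on the set `s`. -/
def SignConstantOn (f : E × ℝ →ₗ[ℝ] ℝ) (s : Finset E) : Prop :=
  (∀ v ∈ s, 0 ≤ f (v, 1)) ∨ ∀ v ∈ s, f (v, 1) ≤ 0

lemma SignConstantOn.neg {f : E × ℝ →ₗ[ℝ] ℝ} {s : Finset E} (h : SignConstantOn f s) :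
    SignConstantOn (-f) s := by
  simpa [SignConstantOn, or_comm] using h

lemma apply_weightedSum (f : E × ℝ →ₗ[ℝ] ℝ) {s : Finset E} {c : E →₀ ℝ} (hc : c.support ⊆ s) :
    f (weightedSum id c) = ∑ v ∈ s, c v * f (v, 1) := by
  rw [weightedSum, Finsupp.linearCombination_apply,
    Finsupp.sum_of_support_subset c hc _ (by simp), map_sum]
  simp only [map_smul, smul_eq_mul, id]

lemma nonneg_of_mem_convexHull {f : E × ℝ →ₗ[ℝ] ℝ} {s : Finset E} {x : E}
    (hx : x ∈ convexHull ℝ (s : Set E)) (h : ∀ v ∈ s, 0 ≤ f (v, 1)) : 0 ≤ f (x, 1) := by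
  obtain ⟨c, hc0, hcs, hcx⟩ := (mem_convexHull_finset_iff _ _).1 hx
  rw [← hcx, apply_weightedSum f hcs]
  exact Finset.sum_nonneg fun v hv => mul_nonneg (hc0 v) (h v hv)

lemma nonpos_of_mem_convexHull {f : E × ℝ →ₗ[ℝ] ℝ} {s : Finset E} {x : E}
    (hx : x ∈ convexHull ℝ (s : Set E)) (h : ∀ v ∈ s, f (v, 1) ≤ 0) : f (x, 1) ≤ 0 := by
  have := nonneg_of_mem_convexHull (f := -f) hx (by simpa using h)
  simpa using this

/-- A simplex on which an affine function takes both signs has a point with positive barycentric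
coordinates at which that function vanishes. -/
lemma exists_weight_eq_zero_or_signConstantOn (f : E × ℝ →ₗ[ℝ] ℝ) {s : Finset E}
    (hs : s.Nonempty) : ∃ w : E →₀ ℝ, 0 ≤ w ∧ w.support = s ∧ (weightedSum id w).2 = 1 ∧
      (f (weightedSum id w) = 0 ∨ SignConstantOn f s) := by
  obtain ⟨w₀, hw₀, hw₀s, hw₀1⟩ : ∃ w : E →₀ ℝ, 0 ≤ w ∧ w.support = s ∧
      (weightedSum id w).2 = 1 := by
    have hcard : (0 : ℝ) < (s.card : ℝ)⁻¹ := inv_pos.2 (by exact_mod_cast hs.card_pos)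
    refine ⟨Finsupp.indicator s fun _ _ => (s.card : ℝ)⁻¹, fun v => ?_, ?_, ?_⟩
    · rw [Finsupp.indicator_apply]
      split_ifs
      exacts [hcard.le, le_rfl]
    · ext v
      simp [Finsupp.indicator_apply, hs.ne_empty]
    · rw [weightedSum_apply_of_support_subset id (Finsupp.support_indicator_subset s _),
        Finset.sum_congr rfl fun v hv => Finsupp.indicator_of_mem hv _]
      simp [hs.ne_empty]
  have key : ∀ f : E × ℝ →ₗ[ℝ] ℝ, 0 ≤ f (weightedSum id w₀) → ¬SignConstantOn f s →
      ∃ w : E →₀ ℝ, 0 ≤ w ∧ w.support = s ∧ (weightedSum id w).2 = 1 ∧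
        f (weightedSum id w) = 0 := by
    intro f hf hsign
    simp only [SignConstantOn, not_or, not_forall, not_le] at hsign
    obtain ⟨⟨v, hv, hfv⟩, -⟩ := hsign
    have hpos : 0 < f (weightedSum id w₀) - f (v, 1) := by linarith
    obtain ⟨a, ha⟩ : ∃ a, a = -f (v, 1) / (f (weightedSum id w₀) - f (v, 1)) := ⟨_, rfl⟩
    obtain ⟨t, ht⟩ : ∃ t, t = f (weightedSum id w₀) / (f (weightedSum id w₀) - f (v, 1)) :=
      ⟨_, rfl⟩
    have ha0 : 0 < a := by rw [ha]; exact div_pos (by linarith) hpos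
    have ht0 : 0 ≤ t := by rw [ht]; exact div_nonneg hf hpos.le
    have hsum : a + t = 1 := by rw [ha, ht]; field_simp; ring
    have hws : weightedSum id (a • w₀ + Finsupp.single v t) =
        a • weightedSum id w₀ + t • (v, (1 : ℝ)) := by
      rw [map_add, map_smul, weightedSum, Finsupp.linearCombination_single]
      rfl
    have hsingle : (0 : E →₀ ℝ) ≤ Finsupp.single v t := Finsupp.single_nonneg.2 ht0
    refine ⟨a • w₀ + Finsupp.single v t, add_nonneg (smul_nonneg ha0.le hw₀) hsingle, ?_, ?_, ?_⟩
    · refine (Finsupp.support_add.trans (Finset.union_subset ?_ ?_)).antisymm fun u hu => ?_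
      · exact Finsupp.support_smul.trans hw₀s.subset
      · exact Finsupp.support_single_subset.trans (by simpa using hv)
      · have h1 : 0 < w₀ u :=
          (hw₀ u).lt_of_ne' (Finsupp.mem_support_iff.1 (by rwa [hw₀s]))
        rw [Finsupp.mem_support_iff]
        exact (add_pos_of_pos_of_nonneg (mul_pos ha0 h1) (hsingle u)).ne'
    · rw [hws]
      simpa [hw₀1] using hsum
    · rw [hws, map_add, map_smul, map_smul, ha, ht, smul_eq_mul, smul_eq_mul]
      ring
  by_cases hsign : SignConstantOn f s
  · exact ⟨w₀, hw₀, hw₀s, hw₀1, Or.inr hsign⟩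
  rcases le_total 0 (f (weightedSum id w₀)) with h | h
  · obtain ⟨w, h0, h1, h2, h3⟩ := key f h hsign
    exact ⟨w, h0, h1, h2, Or.inl h3⟩
  · obtain ⟨w, h0, h1, h2, h3⟩ := key (-f) (by simpa using h)
      (fun h' => hsign (by simpa using h'.neg))
    exact ⟨w, h0, h1, h2, Or.inl (by simpa using h3)⟩

lemma signConstantOn_image_of_chain {f : E × ℝ →ₗ[ℝ] ℝ} {b : Finset E → E}
    {T : Finset (Finset E)} (hchain : ∀ A ∈ T, ∀ B ∈ T, A ⊆ B ∨ B ⊆ A)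
    (hb : ∀ A ∈ T, b A ∈ convexHull ℝ (A : Set E))
    (hf : ∀ A ∈ T, f (b A, 1) = 0 ∨ SignConstantOn f A) : SignConstantOn f (T.image b) := by
  by_contra h
  simp only [SignConstantOn, not_or, not_forall, not_le, Finset.mem_image] at h
  obtain ⟨⟨_, ⟨A, hA, rfl⟩, hfA⟩, ⟨_, ⟨B, hB, rfl⟩, hfB⟩⟩ := h
  have hnA : ∀ v ∈ A, f (v, 1) ≤ 0 := by
    rcases hf A hA with h | h | h
    · exact absurd h hfA.ne
    · exact absurd (nonneg_of_mem_convexHull (hb A hA) h) hfA.not_ge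
    · exact h
  have hnB : ∀ v ∈ B, 0 ≤ f (v, 1) := by
    rcases hf B hB with h | h | h
    · exact absurd h hfB.ne'
    · exact h
    · exact absurd (nonpos_of_mem_convexHull (hb B hB) h) hfB.not_ge
  rcases hchain A hA B hB with h | h
  · exact hfA.not_ge (nonneg_of_mem_convexHull (hb A hA) fun v hv => hnB v (h hv))
  · exact hfB.not_ge (nonpos_of_mem_convexHull (hb B hB) fun v hv => hnA v (h hv))

lemma IsDerivedSubdivision.signConstantOn {K' K : Geometry.SimplicialComplex ℝ E}
    (h : IsDerivedSubdivision K' K) {f : E × ℝ →ₗ[ℝ] ℝ} (hf : ∀ s ∈ K.faces, SignConstantOn f s) :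
    ∀ s ∈ K'.faces, SignConstantOn f s := by
  obtain ⟨b, hb, hK'⟩ := h
  rw [hK']
  rintro _ ⟨T, hT, -, hchain, rfl⟩
  exact signConstantOn_image_of_chain hchain
    (fun A hA => intrinsicInterior_subset (hb A (hT hA))) fun A hA => Or.inr (hf A (hT hA))

lemma exists_isDerivedSubdivision_signConstantOn [FiniteDimensional ℝ E]
    (K : Geometry.SimplicialComplex ℝ E) (f : E × ℝ →ₗ[ℝ] ℝ) :
    ∃ K' : Geometry.SimplicialComplex ℝ E, IsDerivedSubdivision K' K ∧ K.space ⊆ K'.space ∧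
      ∀ s ∈ K'.faces, SignConstantOn f s := by
  have hex : ∀ s : Finset E, ∃ w : E →₀ ℝ, s ∈ K.faces → 0 ≤ w ∧ w.support = s ∧
      (weightedSum id w).2 = 1 ∧ (f (weightedSum id w) = 0 ∨ SignConstantOn f s) := by
    intro s
    by_cases hs : s ∈ K.faces
    · obtain ⟨w, hw⟩ := exists_weight_eq_zero_or_signConstantOn f (K.nonempty_of_mem_faces hs)
      exact ⟨w, fun _ => hw⟩
    · exact ⟨0, fun h => absurd h hs⟩
  choose β hβ using hex
  have hb : ∀ s ∈ K.faces, weightedSum id (β s) = ((weightedSum id (β s)).1, 1) :=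
    fun s hs => Prod.ext rfl (hβ s hs).2.2.1
  obtain ⟨K', hspace, hK'⟩ := exists_derived_of_weights K β (fun s => (weightedSum id (β s)).1)
    (fun s hs => ⟨(hβ s hs).1, (hβ s hs).2.1⟩) hb
  have hint : ∀ s ∈ K.faces,
      (weightedSum id (β s)).1 ∈ intrinsicInterior ℝ (convexHull ℝ (s : Set E)) :=
    fun s hs => (K.indep hs).mem_intrinsicInterior_of_pos (hβ s hs).1 (hβ s hs).2.1 (hb s hs)
  refine ⟨K', ⟨_, hint, hK'⟩, hspace, ?_⟩
  rw [hK']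
  rintro _ ⟨T, hT, -, hchain, rfl⟩
  refine signConstantOn_image_of_chain hchain
    (fun A hA => intrinsicInterior_subset (hint A (hT hA))) fun A hA => ?_
  rw [← hb A (hT hA)]
  exact (hβ A (hT hA)).2.2.2

/-- Some iterated derived subdivision of `L` has no simplex on which one of finitely many given
affine functions takes both signs. -/
lemma exists_isIterDerived_signConstantOn [FiniteDimensional ℝ E]
    (L : Geometry.SimplicialComplex ℝ E) (Φ : Finset (E × ℝ →ₗ[ℝ] ℝ)) :
    ∃ (r : ℕ) (L' : Geometry.SimplicialComplex ℝ E), IsIterDerived r L' L ∧ L.space ⊆ L'.space ∧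
      ∀ f ∈ Φ, ∀ s ∈ L'.faces, SignConstantOn f s := by
  induction Φ using Finset.induction_on with
  | empty => exact ⟨0, L, rfl, subset_rfl, by simp⟩
  | insert f Φ _ ih =>
    obtain ⟨r, L', hL', hspace, hΦ⟩ := ih
    obtain ⟨L'', hL'', hspace', hf⟩ := exists_isDerivedSubdivision_signConstantOn L' f
    refine ⟨r + 1, L'', ⟨L', hL', hL''⟩, hspace.trans hspace', fun g hg => ?_⟩
    rcases Finset.mem_insert.1 hg with rfl | hg
    · exact hf
    · exact hL''.signConstantOn (hΦ g hg)

/-- If an affine function does not take both signs on a simplex and is nonnegative at a point with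
positive barycentric coordinates, then it is nonnegative on the simplex. -/
lemma SignConstantOn.nonneg_of_weight {f : E × ℝ →ₗ[ℝ] ℝ} {w : E →₀ ℝ} (hw : 0 ≤ w)
    (h : SignConstantOn f w.support) (hf : 0 ≤ f (weightedSum id w)) :
    ∀ v ∈ w.support, 0 ≤ f (v, 1) := by
  rcases h with h | h
  · exact h
  intro v hv
  have hle : ∀ u ∈ w.support, w u * f (u, 1) ≤ 0 := fun u hu =>
    mul_nonpos_of_nonneg_of_nonpos (hw u) (h u hu)
  rw [apply_weightedSum f subset_rfl] at hf
  have h0 := (Finset.sum_eq_zero_iff_of_nonpos hle).1 (le_antisymm (Finset.sum_nonpos hle) hf) v hv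
  exact ((mul_eq_zero.1 h0).resolve_left (Finsupp.mem_support_iff.1 hv)).ge

/-- Let `K` and `L` be (finite) geometric simplicial complexes in `ℝᴺ` with
`|K| ⊆ |L|`. Then there exist `r ∈ ℕ`, an `r`-fold derived subdivision `βʳL` of `L`, and a
subdivision `K'` of `K` such that `K'` is a subcomplex of `βʳL`. -/
theorem statement1 {N : ℕ} (K L : Geometry.SimplicialComplex ℝ (Fin N → ℝ))
    (hKfin : K.faces.Finite) (hLfin : L.faces.Finite)
    (hKL : K.space ⊆ L.space) :
    ∃ (r : ℕ) (L' K' : Geometry.SimplicialComplex ℝ (Fin N → ℝ)),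
      IsIterDerived r L' L ∧ IsSubdivision K' K ∧ K'.faces ⊆ L'.faces := by
  have hΦ : ∀ t : Finset (Fin N → ℝ), ∃ Φ : Finset ((Fin N → ℝ) × ℝ →ₗ[ℝ] ℝ), t ∈ K.faces →
      ∀ x, x ∈ convexHull ℝ (t : Set (Fin N → ℝ)) ↔ ∀ f ∈ Φ, 0 ≤ f (x, 1) := by
    intro t
    by_cases ht : t ∈ K.faces
    · obtain ⟨Φ, hΦ⟩ := (K.indep ht).exists_finset_forall_nonneg_iff
      exact ⟨Φ, fun _ => hΦ⟩
    · exact ⟨∅, fun h => absurd h ht⟩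
  choose Φ hΦ using hΦ
  obtain ⟨r, L', hL', hspace, hsign⟩ :=
    exists_isIterDerived_signConstantOn L (hKfin.toFinset.biUnion Φ)
  refine ⟨r, L',
    { faces := {s | s ∈ L'.faces ∧ ∃ t ∈ K.faces,
        convexHull ℝ (s : Set (Fin N → ℝ)) ⊆ convexHull ℝ (t : Set (Fin N → ℝ))}
      isRelLowerSet_faces := fun s ⟨hs, t, ht, hst⟩ => ⟨L'.nonempty_of_mem_faces hs,
        fun u hu hne => ⟨L'.down_closed hs hu hne, t, ht,
          (convexHull_mono (Finset.coe_subset.2 hu)).trans hst⟩⟩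
      indep := fun hs => L'.indep hs.1
      inter_subset_convexHull := fun hs ht => L'.inter_subset_convexHull hs.1 ht.1 },
    hL', ⟨Set.Subset.antisymm ?_ ?_, fun s hs => hs.2⟩, fun s hs => hs.1⟩
  · intro x hx
    obtain ⟨s, ⟨-, t, ht, hst⟩, hxs⟩ := Geometry.SimplicialComplex.mem_space_iff.1 hx
    exact Geometry.SimplicialComplex.mem_space_iff.2 ⟨t, ht, hst hxs⟩
  · intro x hx
    obtain ⟨t, ht, hxt⟩ := Geometry.SimplicialComplex.mem_space_iff.1 hx
    obtain ⟨s, hs, hxs⟩ := Geometry.SimplicialComplex.mem_space_iff.1 (hspace (hKL hx))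
    obtain ⟨w, hw0, hws, hwx⟩ := (mem_convexHull_finset_iff _ _).1 hxs
    have hwne : w.support.Nonempty := by
      rw [Finsupp.support_nonempty_iff]
      rintro rfl
      simpa using congrArg Prod.snd hwx
    have hw : w.support ∈ L'.faces := L'.down_closed hs hws hwne
    refine Geometry.SimplicialComplex.mem_space_iff.2 ⟨w.support, ⟨hw, t, ht, ?_⟩,
      (mem_convexHull_finset_iff _ _).2 ⟨w, hw0, subset_rfl, hwx⟩⟩
    refine convexHull_min (fun v hv => (hΦ t ht v).2 fun f hf => ?_) (convex_convexHull ℝ _)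
    have hf' : f ∈ hKfin.toFinset.biUnion Φ :=
      Finset.mem_biUnion.2 ⟨t, hKfin.mem_toFinset.2 ht, hf⟩
    exact (hsign f hf' _ hw).nonneg_of_weight hw0 (by rw [hwx]; exact (hΦ t ht x).1 hxt f hf) v hv
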